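/- Let D be a connected C-homogeneous digraph with more than one end and let 𝒞 be a basic cut system of D. Then for each 2-arc P in D and each 𝒞-separator S, at most one vertex of P lies in S. -/

import Mathlib

open Set

universe u

/-- The underlying undirected graph of a digraph given by its edge relation. -/
def UG {V : Type u} (E : V → V → Prop) : SimpleGraph V := SimpleGraph.fromRel E

/-- `E` is a digraph edge relation: irreflexive and antisymmetric. -/
def IsDigraph {V : Type u} (E : V → V → Prop) : Prop :=
  (∀ x, ¬ E x x) ∧ ∀ x y, E x y → ¬ E y x

/-- A ray in a graph: a one-way infinite path. -/
def IsRay {V : Type u} (G : SimpleGraph V) (r : ℕ → V) : Prop :=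
  Function.Injective r ∧ ∀ n, G.Adj (r n) (r (n + 1))

/-- A sequence is eventually in a set. -/
def EventuallyIn {V : Type u} (r : ℕ → V) (C : Set V) : Prop :=
  ∃ N, ∀ n, N ≤ n → r n ∈ C

/-- `C` is a connected component of the subgraph of `G` induced on `W`:
a maximal connected subset of `W`. -/
def IsCompOf {V : Type u} (G : SimpleGraph V) (C W : Set V) : Prop :=
  C.Nonempty ∧ C ⊆ W ∧ (G.induce C).Connected ∧
    ∀ C', C ⊆ C' → C' ⊆ W → (G.induce C').Connected → C' = C

/-- Two rays are equivalent if for every finite vertex set `S` they lie eventually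
in the same component of the graph minus `S`. -/
def RayEquiv {V : Type u} (G : SimpleGraph V) (r r' : ℕ → V) : Prop :=
  ∀ S : Finset V, ∃ C : Set V, IsCompOf G C {v | v ∉ S} ∧
    EventuallyIn r C ∧ EventuallyIn r' C

/-- The graph has more than one end: two inequivalent rays. -/
def MoreThanOneEnd {V : Type u} (G : SimpleGraph V) : Prop :=
  ∃ r r' : ℕ → V, IsRay G r ∧ IsRay G r' ∧ ¬ RayEquiv G r r'

/-- The graph has infinitely many ends: arbitrarily large families of pairwise
inequivalent rays. -/
def InfinitelyManyEnds {V : Type u} (G : SimpleGraph V) : Prop :=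
  ∀ n : ℕ, ∃ f : Fin n → (ℕ → V), (∀ i, IsRay G (f i)) ∧
    ∀ i j, i ≠ j → ¬ RayEquiv G (f i) (f j)

/-- A separation of a graph: a pair of vertex sets covering `V` such that every
edge lies within one side. -/
def IsSeparation {V : Type u} (G : SimpleGraph V) (c : Set V × Set V) : Prop :=
  c.1 ∪ c.2 = univ ∧ ∀ x y, G.Adj x y → (x ∈ c.1 ∧ y ∈ c.1) ∨ (x ∈ c.2 ∧ y ∈ c.2)

/-- The order of a separation: the number of vertices in its separator. -/
noncomputable def sepOrder {V : Type u} (c : Set V × Set V) : ℕ := (c.1 ∩ c.2).ncard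

/-- The neighbourhood of a vertex set. -/
def Nbhd {V : Type u} (G : SimpleGraph V) (A : Set V) : Set V :=
  {v | v ∉ A ∧ ∃ u ∈ A, G.Adj u v}

/-- The separation `(A, ∼)`. -/
def tildeSep {V : Type u} (G : SimpleGraph V) (A : Set V) : Set V × Set V :=
  (A, Aᶜ ∪ Nbhd G Aᶜ)

/-- `S` separates the wings of the separation `c`: every walk from one wing to
the other meets `S`. -/
def SeparatesWings {V : Type u} (G : SimpleGraph V) (c : Set V × Set V) (S : Set V) : Prop :=
  ∀ a ∈ c.1 \ c.2, ∀ b ∈ c.2 \ c.1, ∀ w : G.Walk a b, ∃ v ∈ w.support, v ∈ S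

/-- A separation of finite order with non-empty wings is essential if its first wing is
connected and no proper subset of the separator separates the wings. -/
def IsEssential {V : Type u} (G : SimpleGraph V) (c : Set V × Set V) : Prop :=
  IsSeparation G c ∧ (c.1 ∩ c.2).Finite ∧ (c.1 \ c.2).Nonempty ∧ (c.2 \ c.1).Nonempty ∧
  (G.induce (c.1 \ c.2)).Connected ∧
  ∀ S, S ⊂ c.1 ∩ c.2 → ¬ SeparatesWings G c S

/-- `C` is a wing of some separation in `𝒞`. -/
def IsWingOf {V : Type u} (𝒞 : Set (Set V × Set V)) (C : Set V) : Prop :=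
  ∃ d ∈ 𝒞, C = d.1 \ d.2 ∨ C = d.2 \ d.1

/-- A cut system. -/
def IsCutSystem {V : Type u} (G : SimpleGraph V) (𝒞 : Set (Set V × Set V)) : Prop :=
  𝒞.Nonempty ∧ (∀ c ∈ 𝒞, IsEssential G c) ∧
  (∀ c ∈ 𝒞, ∃ d ∈ 𝒞, d.1 ⊆ c.2) ∧
  (∀ c ∈ 𝒞, ∀ C : Set V, IsCompOf G C (c.2 \ c.1) →
    (∃ d ∈ 𝒞, d.1 \ d.2 ⊆ C) → tildeSep G (C ∪ Nbhd G C) ∈ 𝒞) ∧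
  (∀ c ∈ 𝒞, ∀ c' ∈ 𝒞, ∃ C₁ C₂ : Set V,
    ((IsCompOf G C₁ ((c.1 \ c.2) ∩ (c'.1 \ c'.2)) ∧
      IsCompOf G C₂ ((c.2 \ c.1) ∩ (c'.2 \ c'.1))) ∨
     (IsCompOf G C₁ ((c.2 \ c.1) ∩ (c'.1 \ c'.2)) ∧
      IsCompOf G C₂ ((c.1 \ c.2) ∩ (c'.2 \ c'.1)))) ∧
    IsWingOf 𝒞 C₁ ∧ IsWingOf 𝒞 C₂)

/-- Pick a side of a separation. -/
def pickSide {V : Type u} (c : Set V × Set V) : Bool → Set V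
  | false => c.1
  | true => c.2

/-- Two cuts are nested (with respect to the cut system `𝒞`). -/
def NestedPair {V : Type u} (G : SimpleGraph V) (𝒞 : Set (Set V × Set V))
    (c d : Set V × Set V) : Prop :=
  ∃ i j : Bool,
    ((¬ ∃ C, IsCompOf G C ((tildeSep G (pickSide c i ∩ pickSide d j)).1 \
        (tildeSep G (pickSide c i ∩ pickSide d j)).2) ∧
        tildeSep G (C ∪ Nbhd G C) ∈ 𝒞) ∨
     (¬ ∃ C, IsCompOf G C ((tildeSep G (pickSide c i ∩ pickSide d j)).2 \
        (tildeSep G (pickSide c i ∩ pickSide d j)).1) ∧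
        tildeSep G (C ∪ Nbhd G C) ∈ 𝒞)) ∧
    (c.1 ∩ c.2) ∪ (d.1 ∩ d.2) ⊆ pickSide c (!i) ∩ pickSide d (!j)

/-- A cut system is nested if each two of its cuts are nested. -/
def IsNestedSystem {V : Type u} (G : SimpleGraph V) (𝒞 : Set (Set V × Set V)) : Prop :=
  ∀ c ∈ 𝒞, ∀ d ∈ 𝒞, NestedPair G 𝒞 c d

/-- `S` is a `𝒞`-separator. -/
def IsSeparatorOf {V : Type u} (𝒞 : Set (Set V × Set V)) (S : Set V) : Prop :=
  ∃ c ∈ 𝒞, c.1 ∩ c.2 = S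

/-- A vertex set contains an end: some ray lies in it. -/
def ContainsEnd {V : Type u} (G : SimpleGraph V) (A : Set V) : Prop :=
  ∃ r : ℕ → V, IsRay G r ∧ ∀ n, r n ∈ A

/-- A basic cut system. -/
def IsBasic {V : Type u} (G : SimpleGraph V) (𝒞 : Set (Set V × Set V)) : Prop :=
  IsCutSystem G 𝒞 ∧
  (∀ c ∈ 𝒞, ∀ d ∈ 𝒞, ¬ sepOrder c < sepOrder d) ∧
  IsNestedSystem G 𝒞 ∧
  (∀ φ : G ≃g G, ∀ c ∈ 𝒞, ((⇑φ '' c.1, ⇑φ '' c.2) : Set V × Set V) ∈ 𝒞) ∧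
  (∀ S S' : Set V, IsSeparatorOf 𝒞 S → IsSeparatorOf 𝒞 S' → ∃ φ : G ≃g G, ⇑φ '' S = S') ∧
  (∀ c ∈ 𝒞, ContainsEnd G c.1 ∧ ContainsEnd G c.2 ∧
    ¬ ∃ d : Set V × Set V, IsSeparation G d ∧ (d.1 ∩ d.2).Finite ∧
      (d.1 ∩ d.2).ncard < sepOrder c ∧ ContainsEnd G d.1 ∧ ContainsEnd G d.2)

/-- The defining property of a `𝒞`-block. -/
def BlockProp {V : Type u} (𝒞 : Set (Set V × Set V)) (X : Set V) : Prop :=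
  (∀ c ∈ 𝒞, (X ⊆ c.1 ∨ X ⊆ c.2) ∧ ¬ (X ⊆ c.1 ∧ X ⊆ c.2)) ∧
  ∃ c ∈ 𝒞, X ⊆ c.1 ∧ c.1 ∩ c.2 ⊆ X

/-- A `𝒞`-block: a maximal vertex set with the block property. -/
def IsCBlock {V : Type u} (𝒞 : Set (Set V × Set V)) (X : Set V) : Prop :=
  BlockProp 𝒞 X ∧ ∀ X', X ⊆ X' → BlockProp 𝒞 X' → X' = X

/-- A digraph is C-homogeneous: every isomorphism between finite induced
subdigraphs with connected underlying graphs extends to an automorphism. -/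
def DigraphCHom {V : Type u} (E : V → V → Prop) : Prop :=
  ∀ (X Y : Set V), X.Finite → Y.Finite → ((UG E).induce X).Connected →
  ∀ φ : X ≃ Y, (∀ a b : X, E a.1 b.1 ↔ E (φ a).1 (φ b).1) →
  ∃ ψ : Equiv.Perm V, (∀ x y, E (ψ x) (ψ y) ↔ E x y) ∧ ∀ a : X, ψ a.1 = (φ a).1

/-- A graph is C-homogeneous: every isomorphism between finite connected induced
subgraphs extends to an automorphism. -/
def GraphCHom {V : Type u} (G : SimpleGraph V) : Prop :=
  ∀ (X Y : Set V), X.Finite → Y.Finite → (G.induce X).Connected →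
  ∀ φ : X ≃ Y, (∀ a b : X, G.Adj a.1 b.1 ↔ G.Adj (φ a).1 (φ b).1) →
  ∃ ψ : G ≃g G, ∀ a : X, ψ a.1 = (φ a).1

/-- The digraph contains a triangle: three pairwise adjacent vertices. -/
def HasTriangle {V : Type u} (E : V → V → Prop) : Prop :=
  ∃ x y z : V, (UG E).Adj x y ∧ (UG E).Adj y z ∧ (UG E).Adj x z

/-- An `n`-arc: a directed path `p 0, p 1, …, p n`. -/
def IsArc {V : Type u} (E : V → V → Prop) (n : ℕ) (p : ℕ → V) : Prop :=
  (∀ i j, i ≤ n → j ≤ n → p i = p j → i = j) ∧ ∀ i < n, E (p i) (p (i + 1))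

/-- A digraph is highly-arc-transitive: for every `n`, its automorphism group acts
transitively on `n`-arcs. -/
def HighlyArcTransitive {V : Type u} (E : V → V → Prop) : Prop :=
  ∀ n : ℕ, ∀ p q : ℕ → V, IsArc E n p → IsArc E n q →
  ∃ ψ : Equiv.Perm V, (∀ x y, E (ψ x) (ψ y) ↔ E x y) ∧ ∀ i ≤ n, ψ (p i) = q i

/-- An alternating walk `w 0, …, w n` in a digraph. -/
def IsAltWalk {V : Type u} (E : V → V → Prop) (n : ℕ) (w : ℕ → V) : Prop :=
  (∀ i < n, E (w i) (w (i + 1)) ∨ E (w (i + 1)) (w i)) ∧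
  ∀ i, i + 2 ≤ n → (E (w i) (w (i + 1)) ↔ E (w (i + 2)) (w (i + 1)))

/-- The edge `e` lies on the walk `w 0, …, w n` (in either direction). -/
def EdgeOnWalk {V : Type u} (n : ℕ) (w : ℕ → V) (e : V × V) : Prop :=
  ∃ i < n, (w i = e.1 ∧ w (i + 1) = e.2) ∨ (w i = e.2 ∧ w (i + 1) = e.1)

/-- Two edges are reachable from each other: they lie on a common alternating walk. -/
def Reach {V : Type u} (E : V → V → Prop) (e f : V × V) : Prop :=
  ∃ n w, IsAltWalk E n w ∧ EdgeOnWalk n w e ∧ EdgeOnWalk n w f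

/-- The edge relation of the reachability digraph `Δ_e`. -/
def DeltaRel {V : Type u} (E : V → V → Prop) (e : V × V) : V → V → Prop :=
  fun x y => E x y ∧ Reach E e (x, y)

/-- The underlying undirected graph of the reachability digraph `Δ_e`. -/
def DeltaGraph {V : Type u} (E : V → V → Prop) (e : V × V) : SimpleGraph V :=
  UG (DeltaRel E e)

/-- Tails of edges of `𝒜(e)`. -/
def Tails {V : Type u} (E : V → V → Prop) (e : V × V) : Set V :=
  {x | ∃ y, DeltaRel E e x y}

/-- Heads of edges of `𝒜(e)`. -/
def Heads {V : Type u} (E : V → V → Prop) (e : V × V) : Set V :=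
  {y | ∃ x, DeltaRel E e x y}

/-- The set of descendants of a vertex. -/
def Descendants {V : Type u} (E : V → V → Prop) (x : V) : Set V :=
  {y | ∃ n p, IsArc E n p ∧ p 0 = x ∧ p n = y}

/-- `(X, Y)` is a bipartition of the graph `G`. -/
def IsBipartition {V : Type u} (G : SimpleGraph V) (X Y : Set V) : Prop :=
  X ∪ Y = univ ∧ Disjoint X Y ∧
  ∀ a b, G.Adj a b → (a ∈ X ∧ b ∈ Y) ∨ (a ∈ Y ∧ b ∈ X)

/-- `G` with sides `X`, `Y` is C-homogeneous bipartite: every isomorphism between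
finite connected induced subgraphs preserving the sides extends to a side-preserving
automorphism. -/
def BipCHom {V : Type u} (G : SimpleGraph V) (X Y : Set V) : Prop :=
  ∀ (A B : Set V), A.Finite → B.Finite → (G.induce A).Connected →
  ∀ φ : A ≃ B, (∀ a b : A, G.Adj a.1 b.1 ↔ G.Adj (φ a).1 (φ b).1) →
  (∀ a : A, a.1 ∈ X ↔ (φ a).1 ∈ X) → (∀ a : A, a.1 ∈ Y ↔ (φ a).1 ∈ Y) →
  ∃ ψ : G ≃g G, (∀ v, v ∈ X ↔ ψ v ∈ X) ∧ (∀ v, v ∈ Y ↔ ψ v ∈ Y) ∧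
    ∀ a : A, ψ a.1 = (φ a).1

/-- `G` with sides `X`, `Y` is homogeneous bipartite: every isomorphism between
finite induced subgraphs preserving the sides extends to a side-preserving
automorphism. -/
def BipHom {V : Type u} (G : SimpleGraph V) (X Y : Set V) : Prop :=
  ∀ (A B : Set V), A.Finite → B.Finite →
  ∀ φ : A ≃ B, (∀ a b : A, G.Adj a.1 b.1 ↔ G.Adj (φ a).1 (φ b).1) →
  (∀ a : A, a.1 ∈ X ↔ (φ a).1 ∈ X) → (∀ a : A, a.1 ∈ Y ↔ (φ a).1 ∈ Y) →
  ∃ ψ : G ≃g G, (∀ v, v ∈ X ↔ ψ v ∈ X) ∧ (∀ v, v ∈ Y ↔ ψ v ∈ Y) ∧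
    ∀ a : A, ψ a.1 = (φ a).1

/-- `G` with sides `X`, `Y` is generic bipartite. -/
def GenericBip {V : Type u} (G : SimpleGraph V) (X Y : Set V) : Prop :=
  (∀ U W : Set V, U ⊆ X → W ⊆ X → U.Finite → W.Finite → Disjoint U W →
    ∃ v ∈ Y, (∀ u ∈ U, G.Adj v u) ∧ ∀ w ∈ W, ¬ G.Adj v w) ∧
  (∀ U W : Set V, U ⊆ Y → W ⊆ Y → U.Finite → W.Finite → Disjoint U W →
    ∃ v ∈ X, (∀ u ∈ U, G.Adj v u) ∧ ∀ w ∈ W, ¬ G.Adj v w)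

section Connectivity

variable {V : Type u} {G : SimpleGraph V}

theorem exists_walk_within {C : Set V} (hC : (G.induce C).Connected) {a b : V}
    (ha : a ∈ C) (hb : b ∈ C) : ∃ w : G.Walk a b, ∀ v ∈ w.support, v ∈ C := by
  obtain ⟨w⟩ := hC.preconnected ⟨a, ha⟩ ⟨b, hb⟩
  refine ⟨w.map (SimpleGraph.Embedding.induce C).toHom, fun v hv => ?_⟩
  obtain ⟨x, -, rfl⟩ := List.mem_map.1 ((SimpleGraph.Walk.support_map _ w) ▸ hv)
  exact x.2

theorem subset_of_connected_of_closed {C D : Set V} (hC : (G.induce C).Connected) {u : V}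
    (huC : u ∈ C) (huD : u ∈ D) (hD : ∀ x ∈ D, ∀ y ∈ C, G.Adj x y → y ∈ D) : C ⊆ D := by
  intro b hb
  by_contra hbD
  obtain ⟨w, hw⟩ := exists_walk_within hC huC hb
  obtain ⟨d, hd, h1, h2⟩ := w.exists_boundary_dart D huD hbD
  exact h2 (hD _ h1 _ (hw _ (w.dart_snd_mem_support_of_mem_darts hd)) d.adj)

/-- A connected subset of `W` lies in a component of `W`. -/
theorem exists_isCompOf {C W : Set V} (hC : (G.induce C).Connected) (hCW : C ⊆ W) :
    ∃ K, C ⊆ K ∧ IsCompOf G K W := by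
  obtain ⟨⟨c, hc⟩⟩ := hC.nonempty
  have key : ∀ C' : Set V, c ∈ C' → C' ⊆ W → (G.induce C').Connected →
      C' ⊆ {x | ∃ w : G.Walk c x, ∀ v ∈ w.support, v ∈ W} := by
    intro C' hc' hW' h' x hx
    obtain ⟨w, hw⟩ := exists_walk_within h' hc' hx
    exact ⟨w, fun v hv => hW' (hw v hv)⟩
  refine ⟨{x | ∃ w : G.Walk c x, ∀ v ∈ w.support, v ∈ W}, key C hc hCW hC, ⟨c, key C hc hCW hC hc⟩,
    ?_, ?_, ?_⟩
  · rintro x ⟨w, hw⟩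
    exact hw _ w.end_mem_support
  · refine SimpleGraph.induce_connected_of_patches c (key C hc hCW hC hc) ?_
    rintro x ⟨w, hw⟩
    refine ⟨{v | v ∈ w.support}, ?_, w.start_mem_support, w.end_mem_support, ?_⟩
    · classical
      intro v hv
      exact ⟨w.takeUntil v hv, fun z hz => hw z (w.support_takeUntil_subset_support hv hz)⟩
    · exact ⟨w.induce _ fun v hv => hv⟩
  · intro C' hK hW h'
    exact (key C' (hK (key C hc hCW hC hc)) hW h').antisymm hK

/-- For any two vertices there are only finitely many minimal separators of a given size. -/
theorem finite_minimal_separators (a b : V) (k : ℕ) (F : Set V) :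
    {S : Set V | F ⊆ S ∧ S.Finite ∧ (S \ F).ncard = k ∧
      (∀ w : G.Walk a b, ∃ v ∈ w.support, v ∈ S) ∧
      ∀ T, T ⊂ S → ∃ w : G.Walk a b, ∀ v ∈ w.support, v ∉ T}.Finite := by
  induction k generalizing F with
  | zero =>
    refine (Set.finite_singleton F).subset ?_
    rintro S ⟨hF, hfin, hcard, -, -⟩
    rw [Set.ncard_eq_zero (hfin.subset sdiff_subset), Set.sdiff_eq_empty] at hcard
    exact hcard.antisymm hF
  | succ k ih =>
    by_cases hsep : ∃ w : G.Walk a b, ∀ v ∈ w.support, v ∉ F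
    · obtain ⟨w, hw⟩ := hsep
      refine ((List.finite_toSet w.support).biUnion fun u _ => ih (insert u F)).subset ?_
      rintro S ⟨hF, hfin, hcard, hS, hmin⟩
      obtain ⟨u, hu, huS⟩ := hS w
      refine Set.mem_biUnion hu ⟨Set.insert_subset huS hF, hfin, ?_, hS, hmin⟩
      have h : S \ insert u F = (S \ F) \ {u} := by
        ext z; simp only [mem_sdiff, mem_insert_iff, mem_singleton_iff]; tauto
      rw [h, Set.ncard_sdiff_singleton_of_mem (show u ∈ S \ F from ⟨huS, hw u hu⟩), hcard]
      rfl
    · refine Set.finite_empty.subset ?_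
      rintro S ⟨hF, hfin, hcard, hS, hmin⟩
      refine hsep (hmin F (hF.ssubset_of_ne ?_))
      rintro rfl
      simp at hcard

end Connectivity

section Wings

variable {V : Type u} {G : SimpleGraph V} {𝒞 : Set (Set V × Set V)}

/-- `C` is the connected wing of a cut in `𝒞` with separator `S`. -/
def IsCutWing (𝒞 : Set (Set V × Set V)) (S C : Set V) : Prop :=
  ∃ c ∈ 𝒞, c.1 ∩ c.2 = S ∧ c.1 \ c.2 = C

/-- The `𝒞`-separators such that `a` and `b` lie in disjoint wings of cuts with that separator. -/
def tightSeparators (𝒞 : Set (Set V × Set V)) (a b : V) : Set (Set V) :=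
  {S | ∃ C C', IsCutWing 𝒞 S C ∧ IsCutWing 𝒞 S C' ∧ Disjoint C C' ∧ a ∈ C ∧ b ∈ C'}

namespace IsCutWing

variable {S C S' C' : Set V}

theorem connected (h𝒞 : IsBasic G 𝒞) (h : IsCutWing 𝒞 S C) : (G.induce C).Connected := by
  obtain ⟨c, hc, rfl, rfl⟩ := h
  exact (h𝒞.1.2.1 c hc).2.2.2.2.1

theorem finite (h𝒞 : IsBasic G 𝒞) (h : IsCutWing 𝒞 S C) : S.Finite := by
  obtain ⟨c, hc, rfl, rfl⟩ := h
  exact (h𝒞.1.2.1 c hc).2.1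

theorem disjoint (h : IsCutWing 𝒞 S C) : Disjoint S C := by
  obtain ⟨c, hc, rfl, rfl⟩ := h
  exact Set.disjoint_left.2 fun x hx hx' => hx'.2 hx.2

theorem mem_of_adj (h𝒞 : IsBasic G 𝒞) (h : IsCutWing 𝒞 S C) {u w : V} (hu : u ∈ C)
    (huw : G.Adj u w) (hw : w ∉ S) : w ∈ C := by
  obtain ⟨c, hc, rfl, rfl⟩ := h
  rcases (h𝒞.1.2.1 c hc).1.2 u w huw with h1 | h1
  · exact ⟨h1.2, fun h2 => hw ⟨h1.2, h2⟩⟩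
  · exact absurd h1.1 hu.2

theorem exists_adj (h𝒞 : IsBasic G 𝒞) (h : IsCutWing 𝒞 S C) {s : V} (hs : s ∈ S) :
    ∃ u ∈ C, G.Adj s u := by
  have h' := h
  obtain ⟨c, hc, rfl, rfl⟩ := h'
  have hlt : (c.1 ∩ c.2) \ {s} ⊂ c.1 ∩ c.2 := Set.sdiff_singleton_ssubset.2 hs
  have hns := (h𝒞.1.2.1 c hc).2.2.2.2.2 _ hlt
  unfold SeparatesWings at hns
  push Not at hns
  obtain ⟨a, ha, b, hb, w, hw⟩ := hns
  obtain ⟨d, hd, h1, h2⟩ := w.exists_boundary_dart (c.1 \ c.2) ha (fun hb' => hb.2 hb'.1)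
  have h3 := hw _ (w.dart_snd_mem_support_of_mem_darts hd)
  have h4 : d.snd ∈ c.1 ∩ c.2 := by
    by_contra h5
    exact h2 (h.mem_of_adj h𝒞 h1 d.adj h5)
  have h5 : d.snd = s := by
    by_contra h6
    exact h3 ⟨h4, h6⟩
  exact ⟨d.fst, h1, h5 ▸ d.adj.symm⟩

theorem subset_of_mem (h𝒞 : IsBasic G 𝒞) (h : IsCutWing 𝒞 S C) {D : Set V}
    (hD : (G.induce D).Connected) (hdisj : Disjoint S D) {u : V} (huD : u ∈ D) (huC : u ∈ C) :
    D ⊆ C :=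
  subset_of_connected_of_closed hD huD huC fun _ hx _ hy hxy =>
    h.mem_of_adj h𝒞 hx hxy (Set.disjoint_right.1 hdisj hy)

/-- No separator meets both a wing and the complement of its side. -/
theorem nested (h𝒞 : IsBasic G 𝒞) (h : IsCutWing 𝒞 S C) (h' : IsCutWing 𝒞 S' C') :
    S' ⊆ C ∪ S ∨ Disjoint S' C := by
  obtain ⟨c, hc, rfl, rfl⟩ := h
  obtain ⟨d, hd, rfl, rfl⟩ := h'
  obtain ⟨i, j, -, hij⟩ := h𝒞.2.2.1 c hc d hd
  have hsub := (Set.subset_union_right.trans hij).trans Set.inter_subset_left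
  cases i
  · exact Or.inr (Set.disjoint_left.2 fun x hx hx' => hx'.2 (hsub hx))
  · refine Or.inl fun x hx => ?_
    have hx1 : x ∈ c.1 := hsub hx
    by_cases hx2 : x ∈ c.2
    · exact Or.inr ⟨hx1, hx2⟩
    · exact Or.inl ⟨hx1, hx2⟩

theorem image (h𝒞 : IsBasic G 𝒞) (h : IsCutWing 𝒞 S C) (φ : G ≃g G) :
    IsCutWing 𝒞 (φ '' S) (φ '' C) := by
  obtain ⟨c, hc, rfl, rfl⟩ := h
  exact ⟨_, h𝒞.2.2.2.1 φ c hc, (Set.image_inter φ.injective).symm,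
    (Set.image_sdiff φ.injective _ _).symm⟩

end IsCutWing

/-- If the wing of a cut lies in the opposite wing of a cut `c`, then it lies in a component of
that opposite wing which is again the wing of a cut with the same separator as `c`. -/
theorem exists_isCutWing_of_subset (h𝒞 : IsBasic G 𝒞) {c d : Set V × Set V} (hc : c ∈ 𝒞)
    (hd : d ∈ 𝒞) (hdc : d.1 \ d.2 ⊆ c.2 \ c.1) :
    ∃ K, IsCutWing 𝒞 (c.1 ∩ c.2) K ∧ d.1 \ d.2 ⊆ K ∧ K ⊆ c.2 \ c.1 := by
  obtain ⟨K, hdK, hK⟩ := exists_isCompOf (h𝒞.1.2.1 d hd).2.2.2.2.1 hdc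
  have he := h𝒞.1.2.2.2.1 c hc K hK ⟨d, hd, hdK⟩
  obtain ⟨-, hKc, hKconn, hmax⟩ := hK
  obtain ⟨⟨hcov, hedge⟩, hfin, -⟩ := h𝒞.1.2.1 c hc
  have hN : Nbhd G K ⊆ c.1 ∩ c.2 := by
    rintro v ⟨hvK, u, hu, huv⟩
    have hv2 : v ∈ c.2 := by
      rcases hedge u v huv with h1 | h1
      · exact absurd h1.1 (hKc hu).2
      · exact h1.2
    refine ⟨?_, hv2⟩
    by_contra hv1
    have hconn : (G.induce (insert v K)).Connected := by
      rw [Set.insert_eq, Set.union_comm]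
      exact SimpleGraph.connected_induce_union hKconn.preconnected
        SimpleGraph.Preconnected.of_subsingleton hu (Set.mem_singleton v) huv
    have := hmax (insert v K) (Set.subset_insert _ _)
      (Set.insert_subset ⟨hv2, hv1⟩ hKc) hconn
    exact hvK (this ▸ Set.mem_insert v K)
  set e := tildeSep G (K ∪ Nbhd G K)
  have he2 : e.1 ∩ e.2 ⊆ Nbhd G K := by
    rintro x ⟨hx1, hx2⟩
    rcases hx1 with hxK | hx1
    · exfalso
      rcases hx2 with hx2 | ⟨-, u, hu, hux⟩
      · exact hx2 (Or.inl hxK)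
      · refine hu ?_
        by_cases huK : u ∈ K
        · exact Or.inl huK
        · exact Or.inr ⟨huK, x, hxK, hux.symm⟩
    · exact hx1
  have heq : e.1 ∩ e.2 = c.1 ∩ c.2 :=
    Set.eq_of_subset_of_ncard_le (he2.trans hN) (not_lt.1 (h𝒞.2.1 e he c hc)) hfin
  have hNK : Nbhd G K = c.1 ∩ c.2 := hN.antisymm (heq ▸ he2)
  refine ⟨K, ⟨e, he, heq, ?_⟩, hdK, hKc⟩
  have h1 : e.1 \ e.2 = e.1 \ (e.1 ∩ e.2) := (Set.sdiff_self_inter).symm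
  rw [h1, heq, ← hNK]
  ext x
  constructor
  · rintro ⟨hx | hx, hx'⟩
    · exact hx
    · exact absurd hx hx'
  · exact fun hx => ⟨Or.inl hx, fun h => h.1 hx⟩

theorem IsCutWing.exists_disjoint (h𝒞 : IsBasic G 𝒞) {S C : Set V} (h : IsCutWing 𝒞 S C) :
    ∃ C', IsCutWing 𝒞 S C' ∧ Disjoint C C' := by
  have h' := h
  obtain ⟨c, hc, rfl, rfl⟩ := h'
  obtain ⟨d, hd, hdc⟩ := h𝒞.1.2.2.1 c hc
  have hsub : d.1 \ d.2 ⊆ c.2 \ c.1 := by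
    rintro x ⟨hx1, hx2⟩
    refine ⟨hdc hx1, fun hxc => ?_⟩
    obtain ⟨u, hu, hxu⟩ := h.exists_adj h𝒞 ⟨hxc, hdc hx1⟩
    rcases (h𝒞.1.2.1 d hd).1.2 x u hxu with h1 | h1
    · exact hu.2 (hdc h1.2)
    · exact hx2 h1.1
  obtain ⟨K, hK, -, hKc⟩ := exists_isCutWing_of_subset h𝒞 hc hd hsub
  exact ⟨K, hK, Set.disjoint_left.2 fun x hx hx' => (hKc hx').2 hx.1⟩

/-- A wing that avoids a separator `S'` lies in a wing of a cut with separator `S'`. -/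
theorem IsCutWing.exists_superset (h𝒞 : IsBasic G 𝒞) {S C S' D : Set V} (h : IsCutWing 𝒞 S C)
    (h' : IsCutWing 𝒞 S' D) (hdisj : Disjoint S' C) : ∃ K, IsCutWing 𝒞 S' K ∧ C ⊆ K := by
  by_cases hCD : ∃ u ∈ C, u ∈ D
  · obtain ⟨u, huC, huD⟩ := hCD
    exact ⟨D, h', h'.subset_of_mem h𝒞 (h.connected h𝒞) hdisj huC huD⟩
  · push Not at hCD
    obtain ⟨c, hc, rfl, rfl⟩ := h
    obtain ⟨d, hd, rfl, rfl⟩ := h'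
    have hsub : c.1 \ c.2 ⊆ d.2 \ d.1 := by
      intro x hx
      have hx1 : x ∉ d.1 := by
        intro hx1
        by_cases hx2 : x ∈ d.2
        · exact Set.disjoint_left.1 hdisj ⟨hx1, hx2⟩ hx
        · exact hCD x hx ⟨hx1, hx2⟩
      have hx2 : x ∈ d.1 ∪ d.2 := (h𝒞.1.2.1 d hd).1.1 ▸ Set.mem_univ x
      exact ⟨hx2.resolve_left hx1, hx1⟩
    obtain ⟨K, hK, hcK, -⟩ := exists_isCutWing_of_subset h𝒞 hd hc hsub
    exact ⟨K, hK, hcK⟩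

theorem finite_tightSeparators (h𝒞 : IsBasic G 𝒞) (a b : V) : (tightSeparators 𝒞 a b).Finite := by
  rcases (tightSeparators 𝒞 a b).eq_empty_or_nonempty with h0 | ⟨S₀, C₀, -, ⟨c₀, hc₀, rfl, rfl⟩, -⟩
  · rw [h0]; exact Set.finite_empty
  refine (finite_minimal_separators (G := G) a b (c₀.1 ∩ c₀.2).ncard ∅).subset ?_
  rintro S ⟨C, C', hC, hC', hdisj, haC, hbC'⟩
  refine ⟨Set.empty_subset _, hC.finite h𝒞, ?_, ?_, ?_⟩
  · rw [Set.sdiff_empty]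
    obtain ⟨c, hc, rfl, -⟩ := hC
    exact le_antisymm (not_lt.1 (h𝒞.2.1 c₀ hc₀ c hc)) (not_lt.1 (h𝒞.2.1 c hc c₀ hc₀))
  · intro w
    obtain ⟨d, hd, h1, h2⟩ := w.exists_boundary_dart C haC (Set.disjoint_right.1 hdisj hbC')
    refine ⟨d.snd, w.dart_snd_mem_support_of_mem_darts hd, ?_⟩
    by_contra h3
    exact h2 (hC.mem_of_adj h𝒞 h1 d.adj h3)
  · intro T hT
    obtain ⟨s, hsS, hsT⟩ := Set.exists_of_ssubset hT
    obtain ⟨u, hu, hsu⟩ := hC.exists_adj h𝒞 hsS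
    obtain ⟨u', hu', hsu'⟩ := hC'.exists_adj h𝒞 hsS
    obtain ⟨w, hw⟩ := exists_walk_within (hC.connected h𝒞) haC hu
    obtain ⟨w', hw'⟩ := exists_walk_within (hC'.connected h𝒞) hu' hbC'
    refine ⟨w.append (.cons hsu.symm (.cons hsu' w')), fun v hv hvT => ?_⟩
    rw [SimpleGraph.Walk.mem_support_append_iff] at hv
    simp only [SimpleGraph.Walk.support_cons, List.mem_cons] at hv
    have hvS := hT.subset hvT
    rcases hv with hv | rfl | rfl | hv
    · exact Set.disjoint_left.1 hC.disjoint hvS (hw v hv)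
    · exact Set.disjoint_left.1 hC.disjoint hvS hu
    · exact hsT hvT
    · exact Set.disjoint_left.1 hC'.disjoint hvS (hw' v hv)

theorem image_mem_tightSeparators (h𝒞 : IsBasic G 𝒞) (φ : G ≃g G) {a b : V} {S : Set V}
    (hS : S ∈ tightSeparators 𝒞 a b) : φ '' S ∈ tightSeparators 𝒞 (φ a) (φ b) := by
  obtain ⟨C, C', hC, hC', hdisj, ha, hb⟩ := hS
  exact ⟨_, _, hC.image h𝒞 φ, hC'.image h𝒞 φ, (Set.disjoint_image_iff φ.injective).2 hdisj,
    Set.mem_image_of_mem _ ha, Set.mem_image_of_mem _ hb⟩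

theorem ncard_tightSeparators_le (h𝒞 : IsBasic G 𝒞) (φ : G ≃g G) (a b : V) :
    (tightSeparators 𝒞 a b).ncard ≤ (tightSeparators 𝒞 (φ a) (φ b)).ncard :=
  Set.ncard_le_ncard_of_injOn (fun S => φ '' S) (fun _ hS => image_mem_tightSeparators h𝒞 φ hS)
    (Set.image_injective.2 φ.injective).injOn (finite_tightSeparators h𝒞 _ _)

/-- If `v`, `a` lie in a common separator and some separator through `v` tightly separates `a`
from `b`, then a neighbour of `v` is tightly separated from `b` by strictly more separators. -/
theorem exists_farther_neighbour (h𝒞 : IsBasic G 𝒞) {v a b : V} {S S' : Set V}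
    (hS : S ∈ tightSeparators 𝒞 a b) (hS' : IsSeparatorOf 𝒞 S') (hvS' : v ∈ S') (haS' : a ∈ S') :
    ∃ a', G.Adj v a' ∧ S' ∈ tightSeparators 𝒞 a' b ∧
      tightSeparators 𝒞 a b ⊂ tightSeparators 𝒞 a' b := by
  obtain ⟨c', hc', hcS'⟩ := hS'
  obtain ⟨C, C', hC, hC', hdisj, haC, hbC'⟩ := hS
  have hD₁ : IsCutWing 𝒞 S' (c'.1 \ c'.2) := ⟨c', hc', hcS', rfl⟩
  obtain ⟨D₂, hD₂, hD₁₂⟩ := hD₁.exists_disjoint h𝒞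
  have hS'C : S' ⊆ C ∪ S := (hC.nested h𝒞 hD₁).resolve_right fun h =>
    Set.disjoint_left.1 h haS' haC
  have hS'C' : Disjoint S' C' := Set.disjoint_left.2 fun x hx hx' => by
    rcases hS'C hx with h | h
    · exact Set.disjoint_left.1 hdisj h hx'
    · exact Set.disjoint_left.1 hC'.disjoint h hx'
  obtain ⟨K, hK, hC'K⟩ := hC'.exists_superset h𝒞 hD₁ hS'C'
  obtain ⟨D, hD, hDK⟩ := hK.exists_disjoint h𝒞
  obtain ⟨a', ha'D, hva'⟩ := hD.exists_adj h𝒞 hvS'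
  have hmem : S' ∈ tightSeparators 𝒞 a' b := ⟨D, K, hD, hK, hDK.symm, ha'D, hC'K hbC'⟩
  refine ⟨a', hva', hmem, ?_, fun hsub => ?_⟩
  · rintro R ⟨Q, Q', hQ, hQ', hQQ', haQ, hbQ'⟩
    refine ⟨Q, Q', hQ, hQ', hQQ', ?_, hbQ'⟩
    have absorb : ∀ M, IsCutWing 𝒞 S' M → Disjoint R M → M ⊆ Q := by
      intro M hM hRM
      obtain ⟨u, huM, hau⟩ := hM.exists_adj h𝒞 haS'
      exact hQ.subset_of_mem h𝒞 (hM.connected h𝒞) hRM huM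
        (hQ.mem_of_adj h𝒞 haQ hau (Set.disjoint_right.1 hRM huM))
    rcases hD.nested h𝒞 hQ with hR | hR
    · have hRK : Disjoint R K := Set.disjoint_left.2 fun x hx hxK => by
        rcases hR hx with h | h
        · exact Set.disjoint_left.1 hDK hxK h
        · exact Set.disjoint_left.1 hK.disjoint h hxK
      exact absurd hbQ' (Set.disjoint_left.1 hQQ' (absorb K hK hRK (hC'K hbC')))
    · exact absorb D hD hR ha'D
  · obtain ⟨Q, -, hQ, -, -, haQ, -⟩ := hsub hmem
    exact Set.disjoint_left.1 hQ.disjoint haS' haQ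

end Wings

section Homogeneity

variable {V : Type u} {E : V → V → Prop} {𝒞 : Set (Set V × Set V)}

theorem adj_UG_iff (hD : IsDigraph E) {x y : V} : (UG E).Adj x y ↔ E x y ∨ E y x := by
  simp only [UG, SimpleGraph.fromRel_adj, ne_eq, and_iff_right_iff_imp]
  rintro h rfl
  exact hD.1 x (or_self_iff.1 h)

/-- An isomorphism between finite induced subdigraphs one of which has a dominating vertex
extends to an automorphism. -/
theorem DigraphCHom.extend (hhom : DigraphCHom E) {n : ℕ} (f g : Fin n → V)
    (hf : Function.Injective f) (hg : Function.Injective g) (m : Fin n)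
    (hm : ∀ i, i ≠ m → (UG E).Adj (f m) (f i)) (hfg : ∀ i j, E (f i) (f j) ↔ E (g i) (g j)) :
    ∃ φ : UG E ≃g UG E, (∀ x y, E (φ x) (φ y) ↔ E x y) ∧ ∀ i, φ (f i) = g i := by
  have hconn : ((UG E).induce (range f)).Connected := by
    rw [SimpleGraph.connected_iff_exists_forall_reachable]
    refine ⟨⟨f m, m, rfl⟩, ?_⟩
    rintro ⟨_, i, rfl⟩
    by_cases hi : i = m
    · subst hi; exact SimpleGraph.Reachable.refl _
    · exact SimpleGraph.Adj.reachable (by simpa using hm i hi)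
  obtain ⟨ψ, hψ, hψf⟩ := hhom (range f) (range g) (finite_range f) (finite_range g) hconn
    ((Equiv.ofInjective f hf).symm.trans (Equiv.ofInjective g hg)) (by
      rintro ⟨_, i, rfl⟩ ⟨_, j, rfl⟩
      simpa [Equiv.ofInjective_symm_apply] using hfg i j)
  refine ⟨⟨ψ, ?_⟩, hψ, fun i => ?_⟩
  · intro x y
    simp [UG, SimpleGraph.fromRel_adj, hψ]
  · simpa [Equiv.ofInjective_symm_apply] using hψf ⟨f i, i, rfl⟩

theorem DigraphCHom.vertex_transitive (hD : IsDigraph E) (hhom : DigraphCHom E) (x y : V) :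
    ∃ φ : UG E ≃g UG E, (∀ x y, E (φ x) (φ y) ↔ E x y) ∧ φ x = y := by
  obtain ⟨φ, hφ, h⟩ := hhom.extend ![x] ![y] (Function.injective_of_subsingleton _)
    (Function.injective_of_subsingleton _) 0 (fun i hi => absurd (Subsingleton.elim i 0) hi)
    (fun i j => by fin_cases i; fin_cases j; simp [hD.1])
  exact ⟨φ, hφ, h 0⟩

theorem DigraphCHom.edge_transitive (hD : IsDigraph E) (hhom : DigraphCHom E) {x y x' y' : V}
    (h : E x y) (h' : E x' y') : ∃ φ : UG E ≃g UG E, φ x = x' ∧ φ y = y' := by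
  have hxy : x ≠ y := by rintro rfl; exact hD.1 _ h
  have hxy' : x' ≠ y' := by rintro rfl; exact hD.1 _ h'
  obtain ⟨φ, -, hφ⟩ := hhom.extend ![x, y] ![x', y']
    (by intro i j; fin_cases i <;> fin_cases j <;> simp [hxy, hxy.symm])
    (by intro i j; fin_cases i <;> fin_cases j <;> simp [hxy', hxy'.symm]) 0
    (by intro i; fin_cases i <;> simp [adj_UG_iff hD, h])
    (by intro i j; fin_cases i <;> fin_cases j <;>
          simp [hD.1, h, h', hD.2 _ _ h, hD.2 _ _ h'])
  exact ⟨φ, hφ 0, hφ 1⟩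

/-- Induced paths on three vertices with matching orientations are equivalent under
automorphisms. -/
theorem DigraphCHom.path_transitive (hD : IsDigraph E) (hhom : DigraphCHom E)
    {x y z x' y' z' : V} (hxz : x ≠ z) (hxz' : x' ≠ z') (hyx : (UG E).Adj y x)
    (hyz : (UG E).Adj y z) (hnxz : ¬ (UG E).Adj x z) (hnxz' : ¬ (UG E).Adj x' z')
    (h1 : E x y ↔ E x' y') (h2 : E y x ↔ E y' x') (h3 : E y z ↔ E y' z')
    (h4 : E z y ↔ E z' y') :
    ∃ φ : UG E ≃g UG E, φ x = x' ∧ φ y = y' ∧ φ z = z' := by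
  have hyx' : (UG E).Adj y' x' := by
    rw [adj_UG_iff hD] at hyx ⊢; rwa [← h1, ← h2]
  have hyz' : (UG E).Adj y' z' := by
    rw [adj_UG_iff hD] at hyz ⊢; rwa [← h3, ← h4]
  have a1 := hyx.ne
  have a2 := hyz.ne
  have a3 := hyx'.ne
  have a4 := hyz'.ne
  rw [adj_UG_iff hD, not_or] at hnxz hnxz'
  obtain ⟨φ, -, hφ⟩ := hhom.extend ![x, y, z] ![x', y', z']
    (by intro i j; fin_cases i <;> fin_cases j <;> simp [hxz, hxz.symm, a1, a2, a1.symm, a2.symm])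
    (by intro i j; fin_cases i <;> fin_cases j <;>
          simp [hxz', hxz'.symm, a3, a4, a3.symm, a4.symm]) 1
    (by intro i; fin_cases i <;> simp [hyx, hyz])
    (by intro i j; fin_cases i <;> fin_cases j <;>
          simp [hD.1, h1, h2, h3, h4, hnxz, hnxz'])
  exact ⟨φ, hφ 0, hφ 1, hφ 2⟩

theorem IsSeparatorOf.image (h𝒞 : IsBasic (UG E) 𝒞) {S : Set V} (hS : IsSeparatorOf 𝒞 S)
    (φ : UG E ≃g UG E) : IsSeparatorOf 𝒞 (φ '' S) := by
  obtain ⟨c, hc, rfl⟩ := hS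
  exact ⟨_, h𝒞.2.2.2.1 φ c hc, (Set.image_inter φ.injective).symm⟩

theorem not_adj_of_mem_tightSeparators {G : SimpleGraph V} (h𝒞 : IsBasic G 𝒞) {a b : V}
    {S : Set V} (hS : S ∈ tightSeparators 𝒞 a b) : a ≠ b ∧ ¬ G.Adj a b := by
  obtain ⟨C, C', hC, hC', hdisj, ha, hb⟩ := hS
  have hbC := Set.disjoint_right.1 hdisj hb
  exact ⟨fun h => hbC (h ▸ ha), fun h => hbC
    (hC.mem_of_adj h𝒞 ha h (Set.disjoint_right.1 hC'.disjoint hb))⟩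

/-- No edge has both its ends in a common separator. -/
theorem not_edge_of_mem_separator (hD : IsDigraph E) (hhom : DigraphCHom E)
    (h𝒞 : IsBasic (UG E) 𝒞) {S : Set V} (hS : IsSeparatorOf 𝒞 S) {x y : V} (hx : x ∈ S)
    (hy : y ∈ S) : ¬ E x y := by
  intro hxy
  have hedge : ∀ v a, (UG E).Adj v a → ∃ S', IsSeparatorOf 𝒞 S' ∧ v ∈ S' ∧ a ∈ S' := by
    intro v a hva
    rcases (adj_UG_iff hD).1 hva with h | h
    · obtain ⟨φ, rfl, rfl⟩ := hhom.edge_transitive hD hxy h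
      exact ⟨_, hS.image h𝒞 φ, mem_image_of_mem _ hx, mem_image_of_mem _ hy⟩
    · obtain ⟨φ, rfl, rfl⟩ := hhom.edge_transitive hD hxy h
      exact ⟨_, hS.image h𝒞 φ, mem_image_of_mem _ hy, mem_image_of_mem _ hx⟩
  have step : ∀ v a b S₁, (UG E).Adj v a → S₁ ∈ tightSeparators 𝒞 a b →
      ∃ a' S₂, (UG E).Adj v a' ∧ S₂ ∈ tightSeparators 𝒞 a' b ∧
        tightSeparators 𝒞 a b ⊂ tightSeparators 𝒞 a' b := by
    intro v a b S₁ hva hS₁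
    obtain ⟨S₂, hS₂, hv, ha⟩ := hedge v a hva
    obtain ⟨a', h⟩ := exists_farther_neighbour h𝒞 hS₁ hS₂ hv ha
    exact ⟨a', S₂, h⟩
  have noiso : ∀ v a a' b S₁ S₂, (UG E).Adj v a → (UG E).Adj v a' → (UG E).Adj v b →
      S₁ ∈ tightSeparators 𝒞 a b → S₂ ∈ tightSeparators 𝒞 a' b →
      tightSeparators 𝒞 a b ⊂ tightSeparators 𝒞 a' b → ¬ (E v a ↔ E v a') := by
    intro v a a' b S₁ S₂ hva hva' hvb hS₁ hS₂ hlt hiff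
    have hiff' : E a v ↔ E a' v := by
      have h1 := (adj_UG_iff hD).1 hva
      have h2 := (adj_UG_iff hD).1 hva'
      have h3 := hD.2 v a
      have h4 := hD.2 v a'
      tauto
    obtain ⟨hne, hnadj⟩ := not_adj_of_mem_tightSeparators h𝒞 hS₁
    obtain ⟨hne', hnadj'⟩ := not_adj_of_mem_tightSeparators h𝒞 hS₂
    obtain ⟨φ, ha, -, hb⟩ := hhom.path_transitive hD hne' hne hva' hvb hnadj' hnadj
      hiff'.symm hiff.symm Iff.rfl Iff.rfl
    have h1 := ncard_tightSeparators_le h𝒞 φ a' b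
    rw [ha, hb] at h1
    exact absurd (Set.ncard_lt_ncard hlt (finite_tightSeparators h𝒞 _ _)) (not_lt.2 h1)
  have hS' := hS
  obtain ⟨c, hc, hcS⟩ := hS'
  have hC : IsCutWing 𝒞 S (c.1 \ c.2) := ⟨c, hc, hcS, rfl⟩
  obtain ⟨C', hC', hdisj⟩ := hC.exists_disjoint h𝒞
  obtain ⟨a₀, ha₀, hxa₀⟩ := hC.exists_adj h𝒞 hx
  obtain ⟨b, hb, hxb⟩ := hC'.exists_adj h𝒞 hx
  have hS₀ : S ∈ tightSeparators 𝒞 a₀ b := ⟨_, _, hC, hC', hdisj, ha₀, hb⟩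
  obtain ⟨a₁, S₁, hxa₁, hS₁, h01⟩ := step x a₀ b S hxa₀ hS₀
  obtain ⟨a₂, S₂, hxa₂, hS₂, h12⟩ := step x a₁ b S₁ hxa₁ hS₁
  have n01 := noiso x a₀ a₁ b S S₁ hxa₀ hxa₁ hxb hS₀ hS₁ h01
  have n12 := noiso x a₁ a₂ b S₁ S₂ hxa₁ hxa₂ hxb hS₁ hS₂ h12
  have n02 := noiso x a₀ a₂ b S S₂ hxa₀ hxa₂ hxb hS₀ hS₂ (h01.trans h12)
  tauto

/-- If a vertex of a separator has both an in-neighbour and an out-neighbour, then it is the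
middle of a 2-arc exactly one of whose ends lies in some wing. -/
theorem exists_crossing_arc (hD : IsDigraph E) (h𝒞 : IsBasic (UG E) 𝒞) {S : Set V} (hS : IsSeparatorOf 𝒞 S) {s p q : V} (hs : s ∈ S)
    (hp : E p s) (hq : E s q) :
    ∃ p q C, IsCutWing 𝒞 S C ∧ E p s ∧ E s q ∧ (p ∈ C ∧ q ∉ C ∨ p ∉ C ∧ q ∈ C) := by
  obtain ⟨c, hc, hcS⟩ := hS
  have hC : IsCutWing 𝒞 S (c.1 \ c.2) := ⟨c, hc, hcS, rfl⟩
  obtain ⟨C', hC', hdisj⟩ := hC.exists_disjoint h𝒞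
  generalize c.1 \ c.2 = C at hC hdisj
  obtain ⟨u, hu, hsu⟩ := hC.exists_adj h𝒞 hs
  obtain ⟨u', hu', hsu'⟩ := hC'.exists_adj h𝒞 hs
  have hu'C := Set.disjoint_right.1 hdisj hu'
  rcases (adj_UG_iff hD).1 hsu with h | h
  · by_cases hpC : p ∈ C
    · rcases (adj_UG_iff hD).1 hsu' with h' | h'
      · exact ⟨p, u', C', hC', hp, h', Or.inr ⟨Set.disjoint_left.1 hdisj hpC, hu'⟩⟩
      · exact ⟨u', u, C, hC, h', h, Or.inr ⟨hu'C, hu⟩⟩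
    · exact ⟨p, u, C, hC, hp, h, Or.inr ⟨hpC, hu⟩⟩
  · by_cases hqC : q ∈ C
    · rcases (adj_UG_iff hD).1 hsu' with h' | h'
      · exact ⟨u, u', C, hC, h, h', Or.inl ⟨hu, hu'C⟩⟩
      · exact ⟨u', q, C', hC', h', hq, Or.inl ⟨hu', Set.disjoint_left.1 hdisj hqC⟩⟩
    · exact ⟨u, q, C, hC, h, hq, Or.inl ⟨hu, hqC⟩⟩

/-- The ends of a 2-arc do not lie in a common separator. -/
theorem not_mem_separator_of_arc (hD : IsDigraph E) (hhom : DigraphCHom E)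
    (h𝒞 : IsBasic (UG E) 𝒞) {S : Set V} (hS : IsSeparatorOf 𝒞 S) {x y z : V} (hxz : x ≠ z)
    (hxy : E x y) (hyz : E y z) (hx : x ∈ S) : z ∉ S := by
  intro hz
  obtain ⟨θ, hθ, hθx⟩ := hhom.vertex_transitive hD y x
  obtain ⟨p, q, C, hC, hp, hq, hpq⟩ := exists_crossing_arc hD h𝒞 hS hx
    (p := θ x) (q := θ z) (hθx ▸ (hθ x y).2 hxy) (hθx ▸ (hθ y z).2 hyz)
  have hno := fun {u v : V} => not_edge_of_mem_separator hD hhom h𝒞 hS (x := u) (y := v)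
  have hpS : p ∉ S := fun h => hno h hx hp
  have hqS : q ∉ S := fun h => hno hx h hq
  have hpq_ne : p ≠ q := by rintro rfl; tauto
  have hpq_nadj : ¬ (UG E).Adj p q := by
    intro h
    rcases hpq with ⟨h1, h2⟩ | ⟨h1, h2⟩
    · exact h2 (hC.mem_of_adj h𝒞 h1 h hqS)
    · exact h1 (hC.mem_of_adj h𝒞 h2 h.symm hpS)
  have hxz_nadj : ¬ (UG E).Adj x z := by
    rw [adj_UG_iff hD, not_or]
    exact ⟨hno hx hz, hno hz hx⟩
  obtain ⟨φ, h1, -, h3⟩ := hhom.path_transitive hD hpq_ne hxz ((adj_UG_iff hD).2 (Or.inr hp))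
    ((adj_UG_iff hD).2 (Or.inl hq)) hpq_nadj hxz_nadj (iff_of_true hp hxy)
    (iff_of_false (hD.2 _ _ hp) (hD.2 _ _ hxy)) (iff_of_true hq hyz)
    (iff_of_false (hD.2 _ _ hq) (hD.2 _ _ hyz))
  have hφ : ∀ v T, φ v ∈ φ '' T ↔ v ∈ T := fun v T => φ.injective.mem_set_image
  rw [← hφ p, ← hφ q, h1, h3] at hpq
  rw [← hφ p, h1] at hpS
  rw [← hφ q, h3] at hqS
  rcases (hC.image h𝒞 φ).nested h𝒞 hC with h | h
  · have := h hx
    have := h hz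
    simp only [mem_union] at *
    tauto
  · have := Set.disjoint_left.1 h hx
    have := Set.disjoint_left.1 h hz
    tauto

end Homogeneity

/-- A 2-arc of a connected C-homogeneous digraph with more than one end meets
each separator of a basic cut system in at most one vertex. -/
theorem stmt_2 {V : Type u} (E : V → V → Prop) (hD : IsDigraph E)
    (hconn : (UG E).Connected) (hhom : DigraphCHom E)
    (hends : MoreThanOneEnd (UG E))
    (𝒞 : Set (Set V × Set V)) (h𝒞 : IsBasic (UG E) 𝒞)
    (S : Set V) (hS : IsSeparatorOf 𝒞 S) :
    ∀ x y z : V, x ≠ y → y ≠ z → x ≠ z → E x y → E y z →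
      (({x, y, z} : Set V) ∩ S).Subsingleton := by
  intro x y z hxy hyz hxz hExy hEyz u hu v hv
  have hno : ∀ {a b : V}, a ∈ S → b ∈ S → ¬ E a b := fun ha hb =>
    not_edge_of_mem_separator hD hhom h𝒞 hS ha hb
  have hends' := not_mem_separator_of_arc hD hhom h𝒞 hS hxz hExy hEyz
  obtain ⟨rfl | rfl | rfl, huS⟩ := hu <;> obtain ⟨rfl | rfl | rfl, hvS⟩ := hv
  · rfl
  · exact absurd hExy (hno huS hvS)
  · exact absurd hvS (hends' huS)
  · exact absurd hExy (hno hvS huS)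
  · rfl
  · exact absurd hEyz (hno huS hvS)
  · exact absurd huS (hends' hvS)
  · exact absurd hEyz (hno hvS huS)
  · rfl
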